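/- arXiv:2112.10818 — 5 statements merged into one kernel-verified Lean document; each statement's English description precedes it below -/
import Mathlib

section
/- Let q = (q_0,…,q_r) ∈ ℚ^{r+1} with q ≠ 0, and let q_diff := (q_0 − 1, …, q_{j(q)} − 1, q_{j(q)+1}, …, q_r), i.e., each of the first j(q)+1 entries of q is decreased by 1 and the remaining entries are unchanged. Then the function x ↦ |𝒴(x)|^{⊗q} is differentiable on (0, 1/e_r) and lim_{x↘0} | (d/dx |𝒴(x)|^{⊗q}) / |𝒴(x)|^{⊗q_diff} | = |q_{j(q)}|. -/
open Real Filter Set Asymptotics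

/-- `iterExp r` is `e_r`: `e_0 = 0`, `e_{k+1} = exp (e_k)`. -/
noncomputable def iterExp : ℕ → ℝ
  | 0 => 0
  | k + 1 => Real.exp (iterExp k)

/-- `logScale j` is `y_j`: `y_0 x = x`, `y_{j+1} x = log |y_j x|`. -/
noncomputable def logScale : ℕ → ℝ → ℝ
  | 0, x => x
  | j + 1, x => Real.log |logScale j x|

/-- The interval `(0, 1/e_r)`, where `1/e_0 = +∞`. -/
noncomputable def scaleDomain (r : ℕ) : Set ℝ :=
  if r = 0 then Set.Ioi 0 else Set.Ioo 0 (iterExp r)⁻¹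

/-- `|𝒴(x)|^{⊗ q} = ∏_{j=0}^r |y_j x| ^ (q j)` (real powers). -/
noncomputable def scaleProd (r : ℕ) (q : Fin (r + 1) → ℚ) (x : ℝ) : ℝ :=
  ∏ j : Fin (r + 1), |logScale j x| ^ (q j : ℝ)

lemma iterExp_nonneg (k : ℕ) : 0 ≤ iterExp k := by
  cases k with
  | zero => simp [iterExp]
  | succ k => simp only [iterExp]; positivity

lemma scaleDomain_pos {r : ℕ} {x : ℝ} (hx : x ∈ scaleDomain r) : 0 < x := by
  unfold scaleDomain at hx
  split_ifs at hx
  · exact hx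
  · exact hx.1

lemma logScale_gt (r : ℕ) (x : ℝ) (hx : x ∈ scaleDomain r) (k : ℕ) (hk : k + 1 ≤ r) :
    iterExp (r - (k + 1)) < |logScale (k + 1) x| := by
  have hpos := scaleDomain_pos hx
  induction k with
  | zero =>
    unfold scaleDomain at hx
    rw [if_neg (by omega)] at hx
    obtain ⟨n, rfl⟩ : ∃ n, r = n + 1 := ⟨r - 1, by omega⟩
    simp only [logScale, abs_of_pos hpos]
    have h1 : Real.log x < - iterExp n := by
      rw [Real.log_lt_iff_lt_exp hpos, Real.exp_neg]
      exact hx.2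
    have := neg_le_abs (Real.log x)
    simp only [zero_add, Nat.add_sub_cancel]
    linarith
  | succ k ih =>
    have ih := ih (by omega)
    obtain ⟨n, hn⟩ : ∃ n, r - (k + 1) = n + 1 := ⟨r - (k + 1) - 1, by omega⟩
    have hn' : r - (k + 1 + 1) = n := by omega
    rw [hn] at ih
    rw [hn']
    have h0 : 0 < |logScale (k + 1) x| := lt_of_le_of_lt (iterExp_nonneg _) ih
    have h2 : iterExp n < Real.log |logScale (k + 1) x| := by
      rw [Real.lt_log_iff_exp_lt h0]
      exact ih
    have h3 : logScale (k + 1 + 1) x = Real.log |logScale (k + 1) x| := rfl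
    rw [h3]
    exact lt_of_lt_of_le h2 (le_abs_self _)

lemma logScale_ne (r : ℕ) (x : ℝ) (hx : x ∈ scaleDomain r) (k : ℕ) (hk : k ≤ r) :
    logScale k x ≠ 0 := by
  cases k with
  | zero => exact (scaleDomain_pos hx).ne'
  | succ k =>
    exact abs_pos.1 (lt_of_le_of_lt (iterExp_nonneg _) (logScale_gt r x hx k hk))

lemma logScale_hasDerivAt (r : ℕ) (x : ℝ) (hx : x ∈ scaleDomain r) (k : ℕ) (hk : k ≤ r) :
    HasDerivAt (logScale k) (∏ i ∈ Finset.range k, (logScale i x)⁻¹) x := by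
  induction k with
  | zero =>
    simp only [Finset.range_zero, Finset.prod_empty]
    exact hasDerivAt_id x
  | succ k ih =>
    have h := (ih (by omega)).log (logScale_ne r x hx k (by omega))
    rw [Finset.prod_range_succ, ← div_eq_mul_inv]
    have : logScale (k + 1) = fun y => Real.log (logScale k y) := by
      funext y
      simp [logScale, Real.log_abs]
    rw [this]
    exact h

lemma abs_rpow_hasDerivAt (f : ℝ → ℝ) (f' x p : ℝ) (hf : HasDerivAt f f' x) (h0 : f x ≠ 0) :
    HasDerivAt (fun y => |f y| ^ p) (|f x| ^ p * (p * (f' * (f x)⁻¹))) x := by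
  have h1 : HasDerivAt (fun y => Real.exp (p * Real.log (f y)))
      (Real.exp (p * Real.log (f x)) * (p * (f' / f x))) x :=
    ((hf.log h0).const_mul p).exp
  have h2 : (fun y => |f y| ^ p) =ᶠ[nhds x] fun y => Real.exp (p * Real.log (f y)) := by
    filter_upwards [hf.continuousAt.eventually_ne h0] with y hy
    rw [Real.rpow_def_of_pos (abs_pos.2 hy), Real.log_abs, mul_comm]
  rw [h2.eq_of_nhds]
  exact h1.congr_of_eventuallyEq h2

/-- The product of inverses of the first `k + 1` scale functions. -/
noncomputable def invProd (k : ℕ) (x : ℝ) : ℝ := ∏ i ∈ Finset.range (k + 1), (logScale i x)⁻¹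

lemma scaleProd_hasDerivAt (r : ℕ) (q : Fin (r + 1) → ℚ) (x : ℝ) (hx : x ∈ scaleDomain r) :
    HasDerivAt (scaleProd r q)
      (scaleProd r q x * ∑ k : Fin (r + 1), (q k : ℝ) * invProd k x) x := by
  have h := HasDerivAt.fun_finsetProd (u := Finset.univ) (x := x)
    (f := fun (k : Fin (r + 1)) y => |logScale k y| ^ (q k : ℝ))
    (fun k _ => abs_rpow_hasDerivAt (logScale k) _ x (q k)
      (logScale_hasDerivAt r x hx k (by omega)) (logScale_ne r x hx k (by omega)))
  refine h.congr_deriv ?_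
  rw [Finset.mul_sum]
  refine Finset.sum_congr rfl fun k _ => ?_
  rw [invProd, Finset.prod_range_succ, smul_eq_mul, ← mul_assoc, scaleProd,
    Finset.prod_erase_mul _ _ (Finset.mem_univ k)]

lemma scaleProd_diff (r : ℕ) (q : Fin (r + 1) → ℚ) (j : Fin (r + 1)) (x : ℝ)
    (hx : x ∈ scaleDomain r) :
    scaleProd r (fun i => if i ≤ j then q i - 1 else q i) x
      = scaleProd r q x * |invProd j x| := by
  have h1 : |invProd j x| = ∏ i : Fin (r + 1), if (i : ℕ) ≤ j then |logScale i x|⁻¹ else 1 := by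
    rw [Fin.prod_univ_eq_prod_range (fun i => if i ≤ (j : ℕ) then |logScale i x|⁻¹ else 1) (r + 1),
      ← Finset.prod_filter, invProd, Finset.abs_prod]
    refine Finset.prod_congr ?_ fun i _ => abs_inv _
    ext i
    simp only [Finset.mem_range, Finset.mem_filter]
    omega
  rw [h1, scaleProd, scaleProd, ← Finset.prod_mul_distrib]
  refine Finset.prod_congr rfl fun i _ => ?_
  have h0 := abs_pos.2 (logScale_ne r x hx i (by omega))
  by_cases h : i ≤ j
  · have h' : (i : ℕ) ≤ j := h
    rw [if_pos h, if_pos h']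
    push_cast
    rw [Real.rpow_sub_one h0.ne', div_eq_mul_inv]
  · have h' : ¬ (i : ℕ) ≤ j := h
    rw [if_neg h, if_neg h', mul_one]

lemma logScale_tendsto (k : ℕ) :
    Tendsto (fun x => |logScale (k + 1) x|) (nhdsWithin 0 (Ioi 0)) atTop := by
  induction k with
  | zero =>
    simp only [logScale, Real.log_abs]
    exact tendsto_abs_atBot_atTop.comp Real.tendsto_log_nhdsGT_zero
  | succ k ih =>
    exact tendsto_abs_atTop_atTop.comp (Real.tendsto_log_atTop.comp ih)

lemma invProd_ne (r : ℕ) (x : ℝ) (hx : x ∈ scaleDomain r) (k : ℕ) (hk : k ≤ r) :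
    invProd k x ≠ 0 := by
  rw [invProd, Finset.prod_ne_zero_iff]
  intro i hi
  rw [Finset.mem_range] at hi
  exact inv_ne_zero (logScale_ne r x hx i (by omega))

lemma inv_tendsto (k : ℕ) :
    Tendsto (fun x => (logScale (k + 1) x)⁻¹) (nhdsWithin 0 (Ioi 0)) (nhds 0) := by
  rw [tendsto_zero_iff_abs_tendsto_zero]
  refine (logScale_tendsto k).inv_tendsto_atTop.congr fun x => ?_
  simp [abs_inv]

lemma ratio_tendsto (r j : ℕ) (hj : j ≤ r) (d : ℕ) :
    Tendsto (fun x => invProd (j + d + 1) x / invProd j x) (nhdsWithin 0 (scaleDomain r))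
      (nhds 0) := by
  have hle : nhdsWithin (0 : ℝ) (scaleDomain r) ≤ nhdsWithin 0 (Ioi 0) :=
    nhdsWithin_mono _ fun x hx => scaleDomain_pos hx
  have hs : ∀ k x, invProd (k + 1) x = invProd k x * (logScale (k + 1) x)⁻¹ := fun k x =>
    Finset.prod_range_succ _ _
  induction d with
  | zero =>
    refine ((inv_tendsto j).mono_left hle).congr' ?_
    filter_upwards [self_mem_nhdsWithin] with x hx
    have := invProd_ne r x hx j hj
    rw [add_zero, hs, mul_div_cancel_left₀ _ this]
  | succ d ih =>
    have h := ih.mul ((inv_tendsto (j + d + 1)).mono_left hle)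
    rw [zero_mul] at h
    refine h.congr fun x => ?_
    rw [← add_assoc, hs (j + d + 1)]
    ring

theorem statement1 (r : ℕ) (q : Fin (r + 1) → ℚ) (hq : q ≠ 0)
    (j : Fin (r + 1)) (hj : q j ≠ 0) (hmin : ∀ i, i < j → q i = 0) :
    (∀ x ∈ scaleDomain r, DifferentiableAt ℝ (scaleProd r q) x) ∧
    Filter.Tendsto
      (fun x => |deriv (scaleProd r q) x /
        scaleProd r (fun i => if i ≤ j then q i - 1 else q i) x|)
      (nhdsWithin 0 (scaleDomain r)) (nhds |(q j : ℝ)|) := by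
  refine ⟨fun x hx => (scaleProd_hasDerivAt r q x hx).differentiableAt, ?_⟩
  have hlim : Tendsto (fun x => ∑ k : Fin (r + 1), (q k : ℝ) * (invProd k x / invProd j x))
      (nhdsWithin 0 (scaleDomain r)) (nhds (∑ k : Fin (r + 1), if k = j then (q k : ℝ) else 0)) := by
    refine tendsto_finsetSum _ fun k _ => ?_
    rcases lt_trichotomy k j with h | h | h
    · rw [if_neg h.ne]
      simpa [hmin k h] using tendsto_const_nhds
    · subst h
      rw [if_pos rfl]
      refine tendsto_const_nhds.congr' ?_
      filter_upwards [self_mem_nhdsWithin] with x hx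
      rw [div_self (invProd_ne r x hx k (by omega)), mul_one]
    · rw [if_neg h.ne']
      have h' : (j : ℕ) < k := h
      obtain ⟨d, hd⟩ : ∃ d, (k : ℕ) = j + d + 1 := ⟨k - j - 1, by omega⟩
      have := (ratio_tendsto r j (by omega) d).const_mul (q k : ℝ)
      rw [mul_zero] at this
      rw [hd]
      exact this
  rw [Finset.sum_ite_eq' Finset.univ j, if_pos (Finset.mem_univ j)] at hlim
  refine hlim.abs.congr' ?_
  filter_upwards [self_mem_nhdsWithin] with x hx
  have hP : scaleProd r q x ≠ 0 := by
    rw [scaleProd, Finset.prod_ne_zero_iff]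
    intro i _
    exact (Real.rpow_pos_of_pos (abs_pos.2 (logScale_ne r x hx i (by omega))) _).ne'
  rw [(scaleProd_hasDerivAt r q x hx).deriv, scaleProd_diff r q j x hx,
    mul_div_mul_left _ _ hP, abs_div, abs_abs, ← abs_div, Finset.sum_div]
  simp only [mul_div_assoc]
end

section
/- Let r ∈ ℕ₀, d ∈ (0, +∞] and θ_0, …, θ_r ∈ ℝ. Define z_0(x) := x − θ_0 and z_j(x) := log|z_{j-1}(x)| − θ_j for 1 ≤ j ≤ r and x ∈ (0,d). Assume: (a) for each j ∈ {0,…,r}, z_j is nonvanishing and of constant sign on (0,d); (b) either θ_0 = 0 or there is ε_0 ∈ (0,1) such that 0 < |z_0(x)| < ε_0·|x| for all x ∈ (0,d); and for each j ∈ {1,…,r}, either θ_j = 0 or there is ε_j ∈ (0,1) such that 0 < |z_j(x)| < ε_j·|log|z_{j-1}(x)|| for all x ∈ (0,d). Then θ_j = 0 for every j ∈ {0,…,r}; in other words, an r-logarithmic scale on a simple set is uniquely determined and its center vanishes. -/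
open Real Filter Set
open scoped ENNReal

theorem statement4 (r : ℕ) (d : ℝ≥0∞) (hd : 0 < d) (θ : ℕ → ℝ)
    (Z : ℕ → ℝ → ℝ)
    (hZ0 : ∀ x : ℝ, Z 0 x = x - θ 0)
    (hZ : ∀ j, j + 1 ≤ r → ∀ x : ℝ, Z (j + 1) x = Real.log |Z j x| - θ (j + 1))
    (ha : ∀ j ≤ r,
      (∀ x : ℝ, 0 < x → ENNReal.ofReal x < d → 0 < Z j x) ∨
      (∀ x : ℝ, 0 < x → ENNReal.ofReal x < d → Z j x < 0))
    (hb0 : θ 0 = 0 ∨ ∃ ε ∈ Set.Ioo (0 : ℝ) 1, ∀ x : ℝ, 0 < x → ENNReal.ofReal x < d →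
      0 < |Z 0 x| ∧ |Z 0 x| < ε * |x|)
    (hb : ∀ j, 1 ≤ j → j ≤ r → (θ j = 0 ∨ ∃ ε ∈ Set.Ioo (0 : ℝ) 1,
      ∀ x : ℝ, 0 < x → ENNReal.ofReal x < d →
        0 < |Z j x| ∧ |Z j x| < ε * abs (Real.log (abs (Z (j - 1) x))))) :
    ∀ j ≤ r, θ j = 0 := by
  have hdom : ∀ᶠ x in nhdsWithin (0 : ℝ) (Set.Ioi 0), 0 < x ∧ ENNReal.ofReal x < d := by
    have h1 : ∀ᶠ x in nhdsWithin (0 : ℝ) (Set.Ioi 0), (0 : ℝ) < x := self_mem_nhdsWithin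
    have h2 : Tendsto ENNReal.ofReal (nhdsWithin (0 : ℝ) (Set.Ioi 0)) (nhds 0) := by
      have := (ENNReal.continuous_ofReal.tendsto (0 : ℝ)).mono_left
        (nhdsWithin_le_nhds (s := Set.Ioi (0 : ℝ)))
      simpa using this
    exact h1.and (h2.eventually (gt_mem_nhds hd))
  have h0 : θ 0 = 0 := by
    rcases hb0 with h | ⟨ε, hε, h⟩
    · exact h
    · have hid : Tendsto (fun x : ℝ => x) (nhdsWithin (0 : ℝ) (Set.Ioi 0)) (nhds 0) :=
        tendsto_id.mono_left nhdsWithin_le_nhds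
      have hl : Tendsto (fun x : ℝ => |x - θ 0|) (nhdsWithin (0 : ℝ) (Set.Ioi 0))
          (nhds |0 - θ 0|) := (hid.sub_const _).abs
      have hr : Tendsto (fun x : ℝ => ε * |x|) (nhdsWithin (0 : ℝ) (Set.Ioi 0))
          (nhds (ε * |0|)) := hid.abs.const_mul _
      have := le_of_tendsto_of_tendsto hl hr (hdom.mono fun x hx => by
        have := (h x hx.1 hx.2).2
        rw [hZ0] at this
        exact this.le)
      simpa using this
  have key : ∀ j ≤ r, Tendsto (fun x => |Real.log (|Z j x|)|)
      (nhdsWithin (0 : ℝ) (Set.Ioi 0)) atTop := by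
    intro j
    induction j with
    | zero =>
      intro _
      have : Tendsto (fun x => |Real.log x|) (nhdsWithin (0 : ℝ) (Set.Ioi 0)) atTop :=
        tendsto_abs_atBot_atTop.comp Real.tendsto_log_nhdsGT_zero
      simpa [hZ0, h0] using this
    | succ j ih =>
      intro hj
      have h1 := ih (by omega)
      have h2 : Tendsto (fun x => |Z (j + 1) x|) (nhdsWithin (0 : ℝ) (Set.Ioi 0)) atTop := by
        refine tendsto_atTop_mono (fun x => ?_) (tendsto_atTop_add_const_right _ (-|θ (j + 1)|) h1)
        rw [hZ j hj x]
        have := abs_sub_abs_le_abs_sub (Real.log (|Z j x|)) (θ (j + 1))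
        linarith
      exact tendsto_abs_atTop_atTop.comp (Real.tendsto_log_atTop.comp h2)
  intro j hj
  rcases j with _ | j
  · exact h0
  · rcases hb (j + 1) (by omega) hj with h | ⟨ε, hε, h⟩
    · exact h
    · exfalso
      have h1 := (key j (by omega)).eventually_gt_atTop (|θ (j + 1)| / (1 - ε))
      obtain ⟨x, hx, hx1⟩ := (hdom.and h1).exists
      have h2 := (h x hx.1 hx.2).2
      rw [hZ j hj x, Nat.add_sub_cancel] at h2
      have h3 := abs_sub_abs_le_abs_sub (Real.log (|Z j x|)) (θ (j + 1))
      rw [div_lt_iff₀ (by linarith [hε.2])] at hx1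
      linarith
end

section
/- Let U ⊆ ℝⁿ be open, g : U → ℝ a function and a ∈ U. Then the following are equivalent: (i) g is real analytic at a; (ii) g is G^∞ at a and there is ε ∈ ℝ_{>0} such that for every v ∈ ℝⁿ with |v| ≤ 1 the function x ↦ g(a + x v) is defined (i.e., a + x v ∈ U) and real analytic on the interval (−ε, ε). -/
open Real Filter Set

/-- `g` is `G^k` (k-times Gateaux-differentiable) at `a`: for every direction `u` the
function `x ↦ g (a + x u)` is `C^k` at `0`, and `u ↦ (d^k/dx^k) g(a + x u)|_{x=0}` is given
by a homogeneous polynomial of degree `k` in `u`. -/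
def IsGateaux (n : ℕ) (g : EuclideanSpace ℝ (Fin n) → ℝ) (a : EuclideanSpace ℝ (Fin n))
    (k : ℕ) : Prop :=
  (∀ u : EuclideanSpace ℝ (Fin n), ContDiffAt ℝ k (fun x : ℝ => g (a + x • u)) 0) ∧
  ∃ P : MvPolynomial (Fin n) ℝ, P.IsHomogeneous k ∧
    ∀ u : EuclideanSpace ℝ (Fin n),
      iteratedDeriv k (fun x : ℝ => g (a + x • u)) 0 = MvPolynomial.eval (fun i => u i) P

theorem aux_contDiff (n : ℕ) (P : MvPolynomial (Fin n) ℝ) (m : WithTop ℕ∞) :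
    ContDiff ℝ m (fun u : EuclideanSpace ℝ (Fin n) => MvPolynomial.eval (fun i => u i) P) := by
  induction P using MvPolynomial.induction_on with
  | C a => simpa using contDiff_const
  | add p q hp hq => simpa using hp.add hq
  | mul_X p i hp =>
    simp only [map_mul, MvPolynomial.eval_X]
    exact hp.mul (by fun_prop)

theorem aux_hom (n k : ℕ) (P : MvPolynomial (Fin n) ℝ) (hP : P.IsHomogeneous k) (t : ℝ)
    (u : EuclideanSpace ℝ (Fin n)) :
    MvPolynomial.eval (fun i => (t • u) i) P = t ^ k * MvPolynomial.eval (fun i => u i) P := by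
  rw [MvPolynomial.eval_eq, MvPolynomial.eval_eq, Finset.mul_sum]
  refine Finset.sum_congr rfl fun d hd => ?_
  have h := hP.degree_eq_sum_deg_support hd
  simp only [PiLp.smul_apply, smul_eq_mul, mul_pow, Finset.prod_mul_distrib,
    Finset.prod_pow_eq_pow_sum]
  have h2 : ∑ i ∈ d.support, d i = k := by
    exact h.symm
  rw [h2]; ring

theorem aux_bound {E : Type} [NormedAddCommGroup E] [NormedSpace ℝ E] (k : ℕ) :
    ∀ (F : E → ℝ) (A : ContinuousMultilinearMap ℝ (fun _ : Fin k => E) ℝ) (v : E) (R C : ℝ)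
      (m : Fin k → E), ContDiff ℝ (⊤ : ℕ∞) F → (∀ x, iteratedFDeriv ℝ k F x = A) →
      (∀ x, ‖x - v‖ ≤ R → |F x| ≤ C) → ∑ i, ‖m i‖ ≤ R → |A m| ≤ 2 ^ k * C := by
  induction k with
  | zero =>
    intro F A v R C m hF hA hb hm
    rw [← hA v]
    simpa using hb v (by simpa using hm)
  | succ k ih =>
    intro F A v R C m hF hA hb hm
    set u := m 0
    have hFk : ∀ j : ℕ, ContDiff ℝ j F := fun j => hF.of_le (by exact_mod_cast le_top)
    have hdiff : Differentiable ℝ (iteratedFDeriv ℝ k F) :=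
      hF.differentiable_iteratedFDeriv (by exact_mod_cast WithTop.coe_lt_top k)
    have hfd : ∀ x w, fderiv ℝ (iteratedFDeriv ℝ k F) x w = A.curryLeft w := by
      intro x w
      ext q
      have := iteratedFDeriv_succ_apply_left (𝕜 := ℝ) (f := F) (x := x) (n := k) (Fin.cons w q)
      rw [hA x] at this
      simp only [Fin.cons_zero, Fin.tail_cons] at this
      rw [← this]; rfl
    have hfd' : ∀ x, fderiv ℝ (iteratedFDeriv ℝ k F) x
        = fderiv ℝ (iteratedFDeriv ℝ k F) 0 := by
      intro x; ext1 w; rw [hfd, hfd]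
    have hconst : ∀ x, iteratedFDeriv ℝ k F (x + u) - iteratedFDeriv ℝ k F x = A.curryLeft u := by
      intro x
      set B := fderiv ℝ (iteratedFDeriv ℝ k F) 0 with hB
      have := is_const_of_fderiv_eq_zero (𝕜 := ℝ) (f := fun x => iteratedFDeriv ℝ k F x - B x)
        (hdiff.sub B.differentiable) (fun y => by
          rw [fderiv_fun_sub (hdiff y) B.differentiableAt, hfd' y]; simp) (x + u) x
      simp only [map_add] at this
      rw [← hfd 0 u, ← hB]
      rw [← sub_eq_zero] at this ⊢
      rw [← this]; abel
    have key := ih (fun x => F (x + u) - F x) (A.curryLeft u) v (R - ‖u‖) (2 * C) (Fin.tail m)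
      (by fun_prop) (fun x => by
        rw [← hconst x, ← iteratedFDeriv_comp_add_right]
        exact iteratedFDeriv_sub_apply (f := fun x => F (x + u)) (g := F)
          (by have := hFk k; fun_prop) (hFk k).contDiffAt)
      (fun x hx => by
        have h1 := hb (x + u) (by
          have : x + u - v = (x - v) + u := by abel
          rw [this]; linarith [norm_add_le (x - v) u])
        have h2 := hb x (by linarith [norm_nonneg u])
        have := abs_sub (F (x + u)) (F x)
        linarith)
      (by rw [Fin.sum_univ_succ] at hm; simp only [Fin.tail]; linarith)
    have hA2 : A.curryLeft u (Fin.tail m) = A m := by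
      simp [ContinuousMultilinearMap.curryLeft_apply, u]
    rw [hA2] at key
    rw [pow_succ]; linarith

theorem aux_norm {E : Type} [NormedAddCommGroup E] [NormedSpace ℝ E] (k : ℕ)
    (F : E → ℝ) (A : ContinuousMultilinearMap ℝ (fun _ : Fin k => E) ℝ) (v : E) (R C : ℝ)
    (hR : 0 < R) (hF : ContDiff ℝ (⊤ : ℕ∞) F) (hA : ∀ x, iteratedFDeriv ℝ k F x = A)
    (hb : ∀ x, ‖x - v‖ ≤ R → |F x| ≤ C) : ‖A‖ ≤ 2 ^ k * C * (k / R) ^ k := by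
  have hC : 0 ≤ C := (abs_nonneg _).trans (hb v (by simpa using hR.le))
  refine A.opNorm_le_bound (by positivity) fun m => ?_
  rcases Nat.eq_zero_or_pos k with rfl | hk
  · have := aux_bound 0 F A v R C m hF hA hb (by simpa using hR.le)
    rw [Real.norm_eq_abs]; simpa using this
  by_cases h0 : ∃ i, m i = 0
  · obtain ⟨i, hi⟩ := h0
    rw [A.map_coord_zero i hi]; simp; positivity
  push Not at h0
  have hk' : (0 : ℝ) < k := by exact_mod_cast hk
  have h := aux_bound k F A v R C (fun i => (R / k / ‖m i‖) • m i) hF hA hb (by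
    have : ∀ i, ‖(R / k / ‖m i‖) • m i‖ = R / k := by
      intro i
      have := norm_pos_iff.2 (h0 i)
      rw [norm_smul, Real.norm_of_nonneg (by positivity)]; field_simp
    simp only [this]; simp; field_simp; rfl)
  rw [A.map_smul_univ, smul_eq_mul, abs_mul, Finset.prod_div_distrib, Finset.prod_const,
    Finset.card_univ, Fintype.card_fin] at h
  have hp : 0 < ∏ i, ‖m i‖ := Finset.prod_pos fun i _ => norm_pos_iff.2 (h0 i)
  rw [abs_of_pos (by positivity)] at h
  rw [Real.norm_eq_abs]
  have e : |A m| = ((R / k) ^ k / (∏ i, ‖m i‖) * |A m|) * ((k / R) ^ k * ∏ i, ‖m i‖) := by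
    rw [div_pow, div_pow]; field_simp
  rw [e, mul_assoc (2 ^ k * C)]
  gcongr

theorem aux_const (n k : ℕ) (P : MvPolynomial (Fin n) ℝ) (hP : P.IsHomogeneous k)
    (x : EuclideanSpace ℝ (Fin n)) :
    iteratedFDeriv ℝ k (fun u : EuclideanSpace ℝ (Fin n) => MvPolynomial.eval (fun i => u i) P) x =
    iteratedFDeriv ℝ k (fun u : EuclideanSpace ℝ (Fin n) => MvPolynomial.eval (fun i => u i) P) 0
    := by
  set F := fun u : EuclideanSpace ℝ (Fin n) => MvPolynomial.eval (fun i => u i) P with hFdef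
  have hF : ∀ m, ContDiff ℝ m F := aux_contDiff n P
  have h1 : ∀ t : ℝ, t ≠ 0 → iteratedFDeriv ℝ k F (t • x) = iteratedFDeriv ℝ k F x := by
    intro t ht
    have e1 := congrFun (iteratedFDeriv_comp_const_smul t (hF k)) x
    have e2 : (fun z => F (t • z)) = (t ^ k) • F := by
      ext z; exact aux_hom n k P hP t z
    rw [e2, iteratedFDeriv_const_smul_apply (hF k).contDiffAt] at e1
    exact (smul_right_injective _ (pow_ne_zero k ht) e1).symm
  have hc : Continuous (fun t : ℝ => iteratedFDeriv ℝ k F (t • x)) :=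
    ((hF k).continuous_iteratedFDeriv le_rfl).comp (by fun_prop)
  have ht : Tendsto (fun t : ℝ => iteratedFDeriv ℝ k F (t • x)) (nhdsWithin 0 {0}ᶜ)
      (nhds (iteratedFDeriv ℝ k F ((0 : ℝ) • x))) := (hc.tendsto 0).mono_left nhdsWithin_le_nhds
  have ht2 : Tendsto (fun t : ℝ => iteratedFDeriv ℝ k F (t • x)) (nhdsWithin 0 {0}ᶜ)
      (nhds (iteratedFDeriv ℝ k F x)) := by
    refine tendsto_const_nhds.congr' ?_
    filter_upwards [self_mem_nhdsWithin] with t ht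
    exact (h1 t ht).symm
  have := tendsto_nhds_unique ht2 ht
  simpa using this

theorem aux_line {E : Type} [NormedAddCommGroup E] [NormedSpace ℝ E] (f : E → ℝ) (a : E)
    (hf : AnalyticAt ℝ f a) (k : ℕ) (u : E) :
    iteratedDeriv k (fun t : ℝ => f (a + t • u)) 0 = iteratedFDeriv ℝ k f a (fun _ => u) := by
  obtain ⟨p, r, hp⟩ := hf
  have h0 : HasFPowerSeriesOnBall (fun y => f (a + y)) p 0 r := by
    have := hp.comp_sub (-a)
    simpa [add_comm] using this
  have h1 : HasFPowerSeriesAt (fun y => f (a + y)) p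
    ((ContinuousLinearMap.toSpanSingleton ℝ u) 0) := by simpa using h0.hasFPowerSeriesAt
  obtain ⟨s, h2⟩ := h1.compContinuousLinearMap
  rw [iteratedDeriv_eq_iteratedFDeriv, ← hp.factorial_smul]
  have := h2.factorial_smul 1 k
  convert! this.symm using 2
  simp [FormalMultilinearSeries.compContinuousLinearMap]

theorem aux_diag (n k : ℕ) (P : MvPolynomial (Fin n) ℝ) (hP : P.IsHomogeneous k)
    (u : EuclideanSpace ℝ (Fin n)) :
    iteratedFDeriv ℝ k (fun u : EuclideanSpace ℝ (Fin n) => MvPolynomial.eval (fun i => u i) P) 0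
      (fun _ => u) = k.factorial * MvPolynomial.eval (fun i => u i) P := by
  have hF := aux_contDiff n P ⊤
  rw [← aux_line _ _ hF.contDiffAt.analyticAt]
  have : (fun t : ℝ => MvPolynomial.eval (fun i => ((0 : EuclideanSpace ℝ (Fin n)) + t • u) i) P)
    = fun t : ℝ => t ^ k * MvPolynomial.eval (fun i => u i) P := by
    ext t; rw [zero_add, aux_hom n k P hP]
  rw [this]
  simp [iteratedDeriv_mul_const_field, Nat.descFactorial_self]

theorem aux_poly (n k : ℕ)
    (A : ContinuousMultilinearMap ℝ (fun _ : Fin k => EuclideanSpace ℝ (Fin n)) ℝ) :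
    ∃ P : MvPolynomial (Fin n) ℝ, P.IsHomogeneous k ∧
      ∀ u : EuclideanSpace ℝ (Fin n), A (fun _ => u) = MvPolynomial.eval (fun i => u i) P := by
  classical
  let b := EuclideanSpace.basisFun (Fin n) ℝ
  refine ⟨∑ r : Fin k → Fin n, MvPolynomial.C (A fun j => b (r j)) *
    ∏ j, MvPolynomial.X (r j), ?_, fun u => ?_⟩
  · refine MvPolynomial.IsHomogeneous.sum _ _ _ fun r _ => ?_
    refine MvPolynomial.IsHomogeneous.C_mul ?_ _
    have := MvPolynomial.IsHomogeneous.prod (R := ℝ) Finset.univ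
      (fun j => MvPolynomial.X (r j)) (fun _ : Fin k => 1)
      (fun j _ => MvPolynomial.isHomogeneous_X ℝ (r j))
    simpa using this
  · have hu : u = ∑ i, u i • b i := by
      simpa [b] using (b.sum_repr u).symm
    have h1 : A (fun _ => u) = A (fun _ => ∑ i, u i • b i) := by rw [← hu]
    rw [h1, A.map_sum (fun _ i => u i • b i), map_sum]
    refine Finset.sum_congr rfl fun r _ => ?_
    rw [A.map_smul_univ (fun j => u (r j)) (fun j => b (r j))]
    simp [mul_comm]

theorem aux_forward (n : ℕ) (U : Set (EuclideanSpace ℝ (Fin n))) (hU : IsOpen U)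
    (g : EuclideanSpace ℝ (Fin n) → ℝ) (a : EuclideanSpace ℝ (Fin n)) (ha : a ∈ U)
    (hg : AnalyticAt ℝ g a) :
      ((∀ k : ℕ, 1 ≤ k → IsGateaux n g a k) ∧
        ∃ ε : ℝ, 0 < ε ∧ ∀ v : EuclideanSpace ℝ (Fin n), ‖v‖ ≤ 1 →
          (∀ x : ℝ, x ∈ Set.Ioo (-ε) ε → a + x • v ∈ U) ∧
          (∀ x : ℝ, x ∈ Set.Ioo (-ε) ε →
            AnalyticAt ℝ (fun y : ℝ => g (a + y • v)) x)) := by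
  have hcomp : ∀ (v : EuclideanSpace ℝ (Fin n)) (x : ℝ), AnalyticAt ℝ g (a + x • v) →
      AnalyticAt ℝ (fun y : ℝ => g (a + y • v)) x := fun v x h =>
    h.comp' (f := fun y : ℝ => a + y • v)
      (analyticAt_const.add (analyticAt_id.smul analyticAt_const))
  refine ⟨fun k _ => ⟨fun u => ?_, ?_⟩, ?_⟩
  · exact (hcomp u 0 (by simpa using hg)).contDiffAt
  · obtain ⟨P, hP, h⟩ := aux_poly n k (iteratedFDeriv ℝ k g a)
    exact ⟨P, hP, fun u => by rw [aux_line g a hg, h]⟩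
  · obtain ⟨ε, hε, h⟩ := Metric.eventually_nhds_iff.1
      (hg.eventually_analyticAt.and (hU.eventually_mem ha))
    refine ⟨ε, hε, fun v hv => ?_⟩
    have hd : ∀ x : ℝ, x ∈ Set.Ioo (-ε) ε → dist (a + x • v) a < ε := by
      intro x hx
      rw [dist_self_add_left, norm_smul, Real.norm_eq_abs]
      have := abs_lt.2 hx
      nlinarith [abs_nonneg x, norm_nonneg v]
    exact ⟨fun x hx => (h (hd x hx)).2, fun x hx => hcomp v x (h (hd x hx)).1⟩

theorem aux_radius (n : ℕ) (P : ℕ → MvPolynomial (Fin n) ℝ) (hP : ∀ k, (P k).IsHomogeneous k)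
    (hb : ∀ u : EuclideanSpace ℝ (Fin n), ∃ M : ℕ, ∀ k : ℕ,
      |MvPolynomial.eval (fun i => u i) (P k)| ≤ k.factorial * (M : ℝ) ^ (k + 1)) :
    ∃ p : FormalMultilinearSeries ℝ (EuclideanSpace ℝ (Fin n)) ℝ, 0 < p.radius ∧
      ∀ k (u : EuclideanSpace ℝ (Fin n)), (k.factorial : ℝ) * p k (fun _ => u) =
        MvPolynomial.eval (fun i => u i) (P k) := by
  let F : ℕ → EuclideanSpace ℝ (Fin n) → ℝ := fun k u => MvPolynomial.eval (fun i => u i) (P k)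
  have hF : ∀ k m, ContDiff ℝ m (F k) := fun k m => aux_contDiff n (P k) m
  let S : ℕ → Set (EuclideanSpace ℝ (Fin n)) := fun M =>
    {u | ∀ k : ℕ, |F k u| ≤ k.factorial * (M : ℝ) ^ (k + 1)}
  have hS : ∀ M, IsClosed (S M) := by
    intro M
    simp only [S, Set.setOf_forall]
    refine isClosed_iInter fun k => ?_
    exact isClosed_le (hF k 0).continuous.abs continuous_const
  obtain ⟨M, v, hv⟩ := nonempty_interior_of_iUnion_of_closed hS (by
    ext u
    simpa [S] using hb u)
  obtain ⟨R, hR, hball⟩ := Metric.nhds_basis_closedBall.mem_iff.1 (mem_interior_iff_mem_nhds.1 hv)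
  let p : FormalMultilinearSeries ℝ (EuclideanSpace ℝ (Fin n)) ℝ := fun k =>
    ((k.factorial : ℝ)⁻¹ ^ 2) • iteratedFDeriv ℝ k (F k) 0
  have hfac : ∀ k : ℕ, (0 : ℝ) < k.factorial := fun k => by exact_mod_cast k.factorial_pos
  have hp : ∀ k, ‖p k‖ ≤ M * (2 * M * Real.exp 1 / R) ^ k := by
    intro k
    have h := aux_norm k (F k) _ v R (k.factorial * (M : ℝ) ^ (k + 1)) hR (hF k _)
      (aux_const n k (P k) (hP k)) (fun x hx => hball (by
        rwa [Metric.mem_closedBall, dist_eq_norm]) k)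
    have h3 : (k : ℝ) ^ k / k.factorial ≤ Real.exp 1 ^ k := by
      rw [← Real.exp_nat_mul, mul_one]
      exact Real.pow_div_factorial_le_exp k (by positivity) k
    have hk := hfac k
    calc ‖p k‖ = (k.factorial : ℝ)⁻¹ ^ 2 * ‖iteratedFDeriv ℝ k (F k) 0‖ := by
          simp only [p]
          rw [norm_smul, Real.norm_of_nonneg (by positivity)]
      _ ≤ (k.factorial : ℝ)⁻¹ ^ 2 *
          (2 ^ k * (k.factorial * (M : ℝ) ^ (k + 1)) * (k / R) ^ k) := by gcongr
      _ = M * (2 * M / R) ^ k * ((k : ℝ) ^ k / k.factorial) := by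
          rw [div_pow, div_pow, mul_pow, pow_succ]; field_simp; ring
      _ ≤ M * (2 * M / R) ^ k * Real.exp 1 ^ k := by gcongr
      _ = M * (2 * M * Real.exp 1 / R) ^ k := by
          rw [mul_assoc, ← mul_pow]; congr 2; ring
  refine ⟨p, ?_, ?_⟩
  · set q : ℝ := 2 * M * Real.exp 1 / R with hq
    have hq0 : 0 ≤ q := by positivity
    have hr : 0 < (q + 1)⁻¹ := by positivity
    have := p.le_radius_of_bound M (r := ⟨(q + 1)⁻¹, hr.le⟩) (fun k => by
      calc ‖p k‖ * ((q + 1)⁻¹) ^ k ≤ M * q ^ k * ((q + 1)⁻¹) ^ k := by gcongr; exact hp k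
        _ = M * (q * (q + 1)⁻¹) ^ k := by rw [mul_pow, mul_assoc]
        _ ≤ M * 1 := by
          gcongr
          apply pow_le_one₀ (by positivity)
          rw [← div_eq_mul_inv, div_le_one (by positivity)]; linarith
        _ = M := mul_one _)
    exact lt_of_lt_of_le (ENNReal.coe_pos.2 (show (0 : NNReal) < ⟨(q + 1)⁻¹, hr.le⟩ from hr)) this
  · intro k u
    have hk := hfac k
    have := aux_diag n k (P k) (hP k) u
    simp only [p, F, ContinuousMultilinearMap.smul_apply, smul_eq_mul]
    rw [this]; field_simp

theorem aux_backward (n : ℕ)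
    (g : EuclideanSpace ℝ (Fin n) → ℝ) (a : EuclideanSpace ℝ (Fin n))
    (hG : ∀ k : ℕ, 1 ≤ k → IsGateaux n g a k) (ε : ℝ) (hε : 0 < ε)
    (hv : ∀ v : EuclideanSpace ℝ (Fin n), ‖v‖ ≤ 1 → ∀ x : ℝ, x ∈ Set.Ioo (-ε) ε →
            AnalyticAt ℝ (fun y : ℝ => g (a + y • v)) x) : AnalyticAt ℝ g a := by
  have hP' : ∀ k, ∃ P : MvPolynomial (Fin n) ℝ, P.IsHomogeneous k ∧
    ∀ u : EuclideanSpace ℝ (Fin n),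
      iteratedDeriv k (fun x : ℝ => g (a + x • u)) 0 = MvPolynomial.eval (fun i => u i) P := by
    intro k
    rcases Nat.eq_zero_or_pos k with rfl | hk
    · exact ⟨MvPolynomial.C (g a), MvPolynomial.isHomogeneous_C _ _, fun u => by simp⟩
    · exact (hG k hk).2
  choose P hP hPd using hP'
  have han : ∀ u : EuclideanSpace ℝ (Fin n), AnalyticAt ℝ (fun y : ℝ => g (a + y • u)) 0 := by
    intro u
    have hs : 0 < ‖u‖ + 1 := by positivity
    have h1 := hv ((‖u‖ + 1)⁻¹ • u) (by
      rw [norm_smul, norm_inv, Real.norm_of_nonneg hs.le, inv_mul_le_one₀ hs]; linarith) 0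
      (by simp [hε])
    have h2 : AnalyticAt ℝ (fun y : ℝ => y * (‖u‖ + 1)) 0 := analyticAt_id.mul analyticAt_const
    have h3 := AnalyticAt.comp' (g := fun y : ℝ => g (a + y • (‖u‖ + 1)⁻¹ • u))
      (f := fun y : ℝ => y * (‖u‖ + 1)) (x := 0) (by simpa using h1) h2
    convert! h3 using 4 with y
    rw [smul_smul, mul_assoc, mul_inv_cancel₀ hs.ne', mul_one]
  obtain ⟨p, hpr, hpd⟩ := aux_radius n P hP (by
    intro u
    obtain ⟨C, r, hC, hr, h⟩ := FormalMultilinearSeries.le_mul_pow_of_radius_pos _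
      (han u).hasFPowerSeriesAt.radius_pos
    obtain ⟨M, hM⟩ := exists_nat_ge (max C r)
    refine ⟨M, fun k => ?_⟩
    have hk := h k
    rw [FormalMultilinearSeries.ofScalars_norm, hPd, norm_div, Real.norm_natCast,
      Real.norm_eq_abs, div_le_iff₀ (by exact_mod_cast k.factorial_pos)] at hk
    calc _ ≤ _ := hk
      _ ≤ (M * (M : ℝ) ^ k) * k.factorial := by
        gcongr
        · exact (le_max_left _ _).trans hM
        · exact (le_max_right _ _).trans hM
      _ = _ := by ring)
  have hps := p.hasFPowerSeriesOnBall hpr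
  have hp0 : AnalyticAt ℝ p.sum 0 := hps.analyticAt
  obtain ⟨δ, hδ, hδa⟩ := Metric.eventually_nhds_iff.1 hp0.eventually_analyticAt
  have hline : ∀ v : EuclideanSpace ℝ (Fin n), ‖v‖ ≤ 1 → ∀ x ∈ Set.Ioo (-(min ε δ)) (min ε δ),
      g (a + x • v) = p.sum (0 + x • v) := by
    intro v hv1
    have hA1 : AnalyticOnNhd ℝ (fun y : ℝ => g (a + y • v)) (Set.Ioo (-(min ε δ)) (min ε δ)) :=
      fun x hx => hv v hv1 x (by
        have := min_le_left ε δ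
        exact ⟨by linarith [hx.1], by linarith [hx.2]⟩)
    have hA2 : AnalyticOnNhd ℝ (fun y : ℝ => p.sum (0 + y • v))
        (Set.Ioo (-(min ε δ)) (min ε δ)) := by
      intro x hx
      refine AnalyticAt.comp' (g := p.sum) (f := fun y : ℝ => 0 + y • v) (hδa ?_)
        (analyticAt_const.add (analyticAt_id.smul analyticAt_const))
      have := abs_lt.2 hx
      have := min_le_right ε δ
      rw [dist_zero_right, zero_add, norm_smul, Real.norm_eq_abs]
      nlinarith [abs_nonneg x, norm_nonneg v]
    have h0 : (0 : ℝ) ∈ Set.Ioo (-(min ε δ)) (min ε δ) := by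
      have := lt_min hε hδ
      exact ⟨by linarith, this⟩
    refine hA1.eqOn_of_preconnected_of_eventuallyEq hA2 isPreconnected_Ioo h0 ?_
    have e1 := (hA1 0 h0).hasFPowerSeriesAt
    have e2 := (hA2 0 h0).hasFPowerSeriesAt
    have e3 : ∀ k, iteratedDeriv k (fun y : ℝ => g (a + y • v)) 0 =
        iteratedDeriv k (fun y : ℝ => p.sum (0 + y • v)) 0 := by
      intro k
      rw [hPd, aux_line p.sum 0 hp0, ← hps.factorial_smul, ← hpd, nsmul_eq_mul]
    simp only [e3] at e1
    have e4 := e1.sub e2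
    rw [sub_self] at e4
    filter_upwards [e4.eventually_eq_zero] with x hx
    exact sub_eq_zero.1 hx
  have hfin : AnalyticAt ℝ (fun y => p.sum (y - a)) a :=
    AnalyticAt.comp' (g := p.sum) (f := fun y => y - a) (by simpa using hp0)
      (analyticAt_id.sub analyticAt_const)
  refine hfin.congr ?_
  filter_upwards [Metric.ball_mem_nhds a (lt_min hε hδ)] with y hy
  rw [Metric.mem_ball, dist_eq_norm] at hy
  by_cases hya : y = a
  · have := hline 0 (by simp) 0 (by simp [hε, hδ])
    subst hya
    simpa using this.symm
  · have hn : 0 < ‖y - a‖ := norm_pos_iff.2 (sub_ne_zero.2 hya)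
    have := hline (‖y - a‖⁻¹ • (y - a)) (by
      rw [norm_smul, norm_inv, norm_norm, inv_mul_cancel₀ hn.ne']) ‖y - a‖
      ⟨by linarith, hy⟩
    rw [smul_smul, mul_inv_cancel₀ hn.ne', one_smul, zero_add, add_sub_cancel] at this
    exact this.symm

theorem statement5 (n : ℕ) (U : Set (EuclideanSpace ℝ (Fin n))) (hU : IsOpen U)
    (g : EuclideanSpace ℝ (Fin n) → ℝ) (a : EuclideanSpace ℝ (Fin n)) (ha : a ∈ U) :
    AnalyticAt ℝ g a ↔
      ((∀ k : ℕ, 1 ≤ k → IsGateaux n g a k) ∧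
        ∃ ε : ℝ, 0 < ε ∧ ∀ v : EuclideanSpace ℝ (Fin n), ‖v‖ ≤ 1 →
          (∀ x : ℝ, x ∈ Set.Ioo (-ε) ε → a + x • v ∈ U) ∧
          (∀ x : ℝ, x ∈ Set.Ioo (-ε) ε →
            AnalyticAt ℝ (fun y : ℝ => g (a + y • v)) x)) := by
  refine ⟨aux_forward n U hU g a ha, ?_⟩
  rintro ⟨hG, ε, hε, h⟩
  exact aux_backward n g a hG ε hε fun v hv => (h v hv).2
end

section
/- Let m, k ∈ ℕ and let ν(k) denote the dimension of the real vector space of homogeneous real polynomials of degree k in m variables. Then for every nonempty open set U ⊆ ℝᵐ there exist points p_1, …, p_{ν(k)} ∈ U such that for every (s_1, …, s_{ν(k)}) ∈ ℝ^{ν(k)} there is a unique homogeneous polynomial P of degree k in m real variables with P(p_i) = s_i for all i ∈ {1, …, ν(k)}. -/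
open Set

lemma finrank_homog (m k : ℕ) :
    Module.finrank ℝ (MvPolynomial.homogeneousSubmodule (Fin m) ℝ k) = (m + k - 1).choose k := by
  rw [MvPolynomial.homogeneousSubmodule_eq_finsupp_supported]
  let e : Sym (Fin m) k ≃ ({d : Fin m →₀ ℕ | d.degree = k} : Set (Fin m →₀ ℕ)) :=
    Sym.equivNatSum (Fin m) k
  haveI : Fintype ({d : Fin m →₀ ℕ | d.degree = k} : Set (Fin m →₀ ℕ)) := Fintype.ofEquiv _ e
  have h := (AddMonoidAlgebra.supportedEquivFinsupp (R := ℝ) (S := ℝ)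
    ({d : Fin m →₀ ℕ | d.degree = k} : Set (Fin m →₀ ℕ))).finrank_eq
  rw [h, Module.finrank_finsupp_self, ← Fintype.card_congr e, Sym.card_sym_eq_choose,
    Fintype.card_fin]

lemma eq_zero_of_open (m : ℕ) (U : Set (Fin m → ℝ)) (hU : IsOpen U) (hne : U.Nonempty)
    (P : MvPolynomial (Fin m) ℝ) (h : ∀ x ∈ U, MvPolynomial.eval x P = 0) : P = 0 := by
  obtain ⟨x, hx⟩ := hne
  obtain ⟨ε, hε, hb⟩ := Metric.isOpen_iff.1 hU x hx
  refine MvPolynomial.funext_set (fun i => Metric.ball (x i) ε) (fun i => ?_) fun y hy => ?_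
  · rw [Real.ball_eq_Ioo]
    exact Ioo_infinite (by linarith)
  · rw [map_zero]
    apply h y (hb _)
    rwa [ball_pi _ hε]

theorem statement8 (m k : ℕ) (hm : 1 ≤ m) (hk : 1 ≤ k)
    (U : Set (Fin m → ℝ)) (hU : IsOpen U) (hne : U.Nonempty) :
    ∃ p : Fin ((m + k - 1).choose k) → (Fin m → ℝ),
      (∀ i, p i ∈ U) ∧
      ∀ s : Fin ((m + k - 1).choose k) → ℝ,
        ∃! P : MvPolynomial (Fin m) ℝ,
          P.IsHomogeneous k ∧ ∀ i, MvPolynomial.eval (p i) P = s i := by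
  have hfr := finrank_homog m k
  have hfin : Module.Finite ℝ (MvPolynomial.homogeneousSubmodule (Fin m) ℝ k) :=
    Module.Finite.iff_fg.2 (MvPolynomial.homogeneousSubmodule_fg _ _ k)
  let V := MvPolynomial.homogeneousSubmodule (Fin m) ℝ k
  let ev : (Fin m → ℝ) → Module.Dual ℝ V := fun x =>
    (MvPolynomial.aeval x).toLinearMap.comp V.subtype
  have hev : ∀ x (P : V), ev x P = MvPolynomial.eval x P.1 := fun x P => by
    simp [ev, MvPolynomial.aeval_eq_eval]
  have hspan : ⊤ ≤ Submodule.span ℝ (ev '' U) := by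
    rw [← Subspace.dualCoannihilator_dualAnnihilator_eq (W := Submodule.span ℝ (ev '' U))]
    have : (Submodule.span ℝ (ev '' U)).dualCoannihilator = ⊥ := by
      rw [eq_bot_iff]
      intro P hP
      rw [Submodule.mem_dualCoannihilator] at hP
      rw [Submodule.mem_bot]
      apply Subtype.ext
      refine eq_zero_of_open m U hU hne _ fun x hx => ?_
      rw [← hev]
      exact hP _ (Submodule.subset_span ⟨x, hx, rfl⟩)
    rw [this, Submodule.dualAnnihilator_bot]
  let b0 := Module.Basis.ofSpan hspan
  have hb0 : ∀ i, b0 i ∈ ev '' U := fun i => Module.Basis.ofSpan_subset hspan ⟨i, rfl⟩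
  haveI := Module.Finite.finite_basis b0
  haveI := Fintype.ofFinite ((linearIndepOn_empty ℝ id).extend (empty_subset (ev '' U)))
  have hcard := Module.finrank_eq_card_basis b0
  rw [Subspace.dual_finrank_eq, hfr] at hcard
  let b := b0.reindex (Fintype.equivFinOfCardEq hcard.symm)
  have hb : ∀ i, b i ∈ ev '' U := fun i => by
    rw [Module.Basis.reindex_apply]
    exact hb0 _
  choose p hpU hp using hb
  refine ⟨p, hpU, ?_⟩
  let L : V →ₗ[ℝ] (Fin ((m + k - 1).choose k) → ℝ) := LinearMap.pi fun i => ev (p i)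
  have hinj : Function.Injective L := by
    rw [injective_iff_map_eq_zero]
    intro P hP
    rw [← Module.forall_dual_apply_eq_zero_iff ℝ]
    intro f
    have : Module.Dual.eval ℝ V P = 0 := b.ext fun i => by
      rw [← hp i]
      exact congrFun hP i
    exact LinearMap.congr_fun this f
  have hsurj : Function.Surjective L :=
    (LinearMap.injective_iff_surjective_of_finrank_eq_finrank (by simp [V, hfr])).1 hinj
  intro s
  obtain ⟨P, hP⟩ := hsurj s
  refine ⟨P.1, ⟨P.2, fun i => ?_⟩, ?_⟩
  · rw [← hev]
    exact congrFun hP i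
  · rintro Q ⟨hQ, hQs⟩
    have : (⟨Q, hQ⟩ : V) = P := hinj (by
      rw [hP]
      funext i
      rw [← hQs i]
      exact hev (p i) ⟨Q, hQ⟩)
    exact congrArg Subtype.val this
end

section
/- Let Λ ⊆ ℚ^{r+1} \ (ℕ₀ × {0}^r) be finite, let e_λ ∈ ℝ \ {0} for each λ ∈ Λ, let 0 < η ≤ 1/e_r, and define h : (0,η) → ℝ by h(x) = Σ_{λ∈Λ} e_λ · |𝒴(x)|^{⊗λ}. Let M ∈ ℕ and suppose there is a function ĥ defined on an open interval around 0 that is C^M at 0 and agrees with h on (0,δ) for some δ > 0. Then ĥ is (M−1)-flat at 0, i.e., all derivatives of ĥ at 0 of order at most M−1 vanish. -/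
open Real Filter Set Asymptotics

open scoped Topology

lemma logScale_one_tendsto : Tendsto (logScale 1) (𝓝[>] (0:ℝ)) atBot := by
  have h : logScale 1 = Real.log := by
    funext x
    simp [logScale]
  rw [h]
  exact Real.tendsto_log_nhdsGT_zero

lemma logScale_abs_tendsto (j : ℕ) :
    Tendsto (fun x => |logScale (j + 1) x|) (𝓝[>] (0:ℝ)) atTop := by
  induction j with
  | zero => exact tendsto_abs_atBot_atTop.comp logScale_one_tendsto
  | succ k ih =>
    exact tendsto_abs_atTop_atTop.comp (Real.tendsto_log_atTop.comp ih)

lemma logScale_tendsto_s13 (j : ℕ) :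
    Tendsto (logScale (j + 2)) (𝓝[>] (0:ℝ)) atTop :=
  Real.tendsto_log_atTop.comp (logScale_abs_tendsto j)

lemma logScale_littleO_succ (j : ℕ) :
    logScale (j + 2) =o[𝓝[>] (0:ℝ)] logScale (j + 1) :=
  (isLittleO_log_id_atTop.comp_tendsto (logScale_abs_tendsto j)).of_abs_right

lemma logScale_littleO (j k : ℕ) :
    logScale (j + k + 2) =o[𝓝[>] (0:ℝ)] logScale (j + 1) := by
  induction k with
  | zero => exact logScale_littleO_succ j
  | succ k ih => exact (logScale_littleO_succ (j + k + 1)).trans ih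

lemma logScale_pos (j : ℕ) : ∀ᶠ x in 𝓝[>] (0:ℝ), 0 < |logScale j x| := by
  cases j with
  | zero =>
    filter_upwards [self_mem_nhdsWithin] with x hx
    exact abs_pos.2 (ne_of_gt hx)
  | succ k => exact (logScale_abs_tendsto k).eventually_gt_atTop 0

lemma logSum_tendsto (r : ℕ) (d : Fin (r + 1) → ℝ) (hd : d ≠ 0) :
    Tendsto (fun x => ∑ i, d i * logScale (i + 1) x) (𝓝[>] (0:ℝ)) atTop ∨
    Tendsto (fun x => ∑ i, d i * logScale (i + 1) x) (𝓝[>] (0:ℝ)) atBot := by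
  classical
  obtain ⟨i0, hi0⟩ := Function.ne_iff.1 hd
  obtain ⟨j, hj, hmin⟩ : ∃ j : Fin (r + 1), d j ≠ 0 ∧ ∀ i < j, d i = 0 := by
    have hwf := wellFounded_lt (α := Fin (r + 1))
    refine ⟨hwf.min {i | d i ≠ 0} ⟨i0, hi0⟩, hwf.min_mem {i | d i ≠ 0} ⟨i0, hi0⟩, ?_⟩
    intro i hi
    by_contra h
    exact hwf.not_lt_min {i | d i ≠ 0} h hi
  have hequiv : IsEquivalent (𝓝[>] (0:ℝ)) (fun x => ∑ i, d i * logScale (i + 1) x)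
      (fun x => d j * logScale (j + 1) x) := by
    have h1 : (fun x => ∑ i ∈ Finset.univ.erase j, d i * logScale (i + 1) x)
        =o[𝓝[>] (0:ℝ)] (fun x => d j * logScale (j + 1) x) := by
      apply IsLittleO.fun_sum
      intro i hi
      have hij : i ≠ j := Finset.ne_of_mem_erase hi
      rcases lt_or_gt_of_ne hij with h | h
      · simp [hmin i h]
      · refine IsLittleO.const_mul_left ?_ _
        rw [isLittleO_const_mul_right_iff hj]
        have h' : (j : ℕ) < i := h
        have := logScale_littleO j ((i : ℕ) - j - 1)
        have e : (j : ℕ) + ((i : ℕ) - j - 1) + 2 = i + 1 := by omega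
        rwa [e] at this
    refine h1.congr' (Eventually.of_forall fun x => ?_) EventuallyEq.rfl
    simp only [Pi.sub_apply]
    rw [← Finset.add_sum_erase _ _ (Finset.mem_univ j)]
    ring
  have key : Tendsto (fun x => d j * logScale (j + 1) x) (𝓝[>] (0:ℝ)) atTop ∨
      Tendsto (fun x => d j * logScale (j + 1) x) (𝓝[>] (0:ℝ)) atBot := by
    have h2 : Tendsto (logScale (j + 1)) (𝓝[>] (0:ℝ)) atTop ∨
        Tendsto (logScale (j + 1)) (𝓝[>] (0:ℝ)) atBot := by
      rcases Nat.eq_zero_or_pos (j : ℕ) with h | h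
      · right; rw [h]; exact logScale_one_tendsto
      · left
        have := logScale_tendsto_s13 ((j : ℕ) - 1)
        have e : (j : ℕ) - 1 + 2 = j + 1 := by omega
        rwa [e] at this
    rcases lt_or_gt_of_ne hj with h | h <;> rcases h2 with h2 | h2
    · right; exact h2.const_mul_atTop_of_neg h
    · left; exact h2.const_mul_atBot_of_neg h
    · left; exact h2.const_mul_atTop h
    · right; exact h2.const_mul_atBot h
  rcases key with h | h
  · left; exact hequiv.symm.tendsto_atTop h
  · right; exact hequiv.symm.tendsto_atBot h

lemma scaleProd_eventually (r : ℕ) (q : Fin (r + 1) → ℚ) :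
    ∀ᶠ x in 𝓝[>] (0:ℝ), scaleProd r q x = Real.exp (∑ i, (q i : ℝ) * logScale (i + 1) x) := by
  have h : ∀ᶠ x in 𝓝[>] (0:ℝ), ∀ i : Fin (r + 1), 0 < |logScale i x| :=
    eventually_all.2 fun i => logScale_pos i
  filter_upwards [h] with x hx
  rw [Real.exp_sum, scaleProd]
  refine Finset.prod_congr rfl fun i _ => ?_
  rw [Real.rpow_def_of_pos (hx i), mul_comm]
  rfl

lemma scaleProd_of_atBot (r : ℕ) (p q : Fin (r + 1) → ℚ)
    (h : Tendsto (fun x => ∑ i, ((p i : ℝ) - q i) * logScale (i + 1) x) (𝓝[>] (0:ℝ)) atBot) :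
    scaleProd r p =o[𝓝[>] (0:ℝ)] scaleProd r q := by
  refine IsLittleO.congr' ?_ ((scaleProd_eventually r p).mono fun x hx => hx.symm)
    ((scaleProd_eventually r q).mono fun x hx => hx.symm)
  rw [isLittleO_iff_tendsto (fun x hx => absurd hx (Real.exp_ne_zero _))]
  refine (Real.tendsto_exp_atBot.comp h).congr fun x => ?_
  rw [Function.comp, ← Real.exp_sub, ← Finset.sum_sub_distrib]
  simp only [sub_mul]

lemma scaleProd_compare (r : ℕ) (p q : Fin (r + 1) → ℚ) (hpq : p ≠ q) :
    scaleProd r p =o[𝓝[>] (0:ℝ)] scaleProd r q ∨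
    scaleProd r q =o[𝓝[>] (0:ℝ)] scaleProd r p := by
  have hd : (fun i => (p i : ℝ) - q i) ≠ 0 := by
    intro h
    apply hpq
    funext i
    have := congrFun h i
    simp only [Pi.zero_apply, sub_eq_zero] at this
    exact_mod_cast this
  rcases logSum_tendsto r _ hd with h | h
  · right
    apply scaleProd_of_atBot
    refine (tendsto_neg_atTop_atBot.comp h).congr fun x => ?_
    simp only [Function.comp, ← Finset.sum_neg_distrib]
    exact Finset.sum_congr rfl fun i _ => by ring
  · left
    exact scaleProd_of_atBot r p q h

lemma exists_dominant {ι : Type*} (f : ι → ℝ → ℝ) (l : Filter ℝ) (S : Finset ι)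
    (hne : S.Nonempty)
    (h : ∀ p ∈ S, ∀ q ∈ S, p ≠ q → f p =o[l] f q ∨ f q =o[l] f p) :
    ∃ q ∈ S, ∀ p ∈ S, p ≠ q → f p =o[l] f q := by
  classical
  induction hne using Finset.Nonempty.cons_induction with
  | singleton a => exact ⟨a, by simp, by simp⟩
  | cons a s ha hs ih =>
    obtain ⟨q, hq, hdom⟩ := ih fun p hp q hq => h p (by simp [hp]) q (by simp [hq])
    have hqa : q ≠ a := fun e => ha (e ▸ hq)
    rcases h q (by simp [hq]) a (by simp) hqa with h1 | h1
    · refine ⟨a, by simp, fun p hp hpa => ?_⟩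
      have hps : p ∈ s := by simpa [hpa] using hp
      by_cases hpq : p = q
      · rwa [hpq]
      · exact (hdom p hps hpq).trans h1
    · refine ⟨q, by simp [hq], fun p hp hpq => ?_⟩
      rcases Finset.mem_cons.1 hp with rfl | hps
      · exact h1
      · exact hdom p hps hpq

lemma all_littleO {ι : Type*} (f : ι → ℝ → ℝ) (l : Filter ℝ) (S : Finset ι) (c : ι → ℝ)
    (hc : ∀ p ∈ S, c p ≠ 0)
    (h : ∀ p ∈ S, ∀ q ∈ S, p ≠ q → f p =o[l] f q ∨ f q =o[l] f p)
    (g : ℝ → ℝ) (hg : (fun x => ∑ p ∈ S, c p * f p x) =o[l] g) :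
    ∀ p ∈ S, f p =o[l] g := by
  classical
  intro p hp
  obtain ⟨q, hq, hdom⟩ := exists_dominant f l S ⟨p, hp⟩ h
  have h1 : (fun x => ∑ i ∈ S.erase q, c i * f i x) =o[l] (fun x => c q * f q x) := by
    apply IsLittleO.fun_sum
    intro i hi
    refine IsLittleO.const_mul_left ?_ _
    rw [isLittleO_const_mul_right_iff (hc q hq)]
    exact hdom i (Finset.mem_of_mem_erase hi) (Finset.ne_of_mem_erase hi)
  have h2 := h1.right_isBigO_add
  have h3 : (fun x => c q * f q x) =o[l] g := by
    refine h2.trans_isLittleO (hg.congr_left fun x => ?_)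
    rw [Finset.sum_erase_add _ _ hq]
  have h4 : f q =o[l] g := (isLittleO_const_mul_left_iff (hc q hq)).1 h3
  by_cases hpq : p = q
  · rwa [hpq]
  · exact (hdom p hp hpq).trans h4

lemma taylor_right (M : ℕ) (f : ℝ → ℝ) (hf : ContDiffAt ℝ (M : ℕ∞) f 0) :
    (fun x => f x - ∑ k ∈ Finset.range (M + 1),
      ((k.factorial : ℝ)⁻¹ * iteratedDeriv k f 0) * x ^ k) =o[𝓝[>] (0:ℝ)] (fun x => x ^ M) := by
  obtain ⟨u, hu, hfu⟩ := hf.contDiffOn (m := (M : ℕ∞)) le_rfl (by simp)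
  obtain ⟨ε, hε, hball⟩ := Metric.mem_nhds_iff.1 hu
  have h0 : (0:ℝ) ∈ Metric.ball (0:ℝ) ε := Metric.mem_ball_self hε
  have ht := taylor_isLittleO (convex_ball (0:ℝ) ε) h0 (n := M)
    (by exact_mod_cast hfu.mono hball)
  rw [Metric.isOpen_ball.nhdsWithin_eq h0] at ht
  refine (ht.mono nhdsWithin_le_nhds).congr (fun x => ?_) (fun x => by simp)
  rw [taylor_within_apply]
  congr 1
  refine Finset.sum_congr rfl fun k _ => ?_
  rw [iteratedDerivWithin_of_isOpen Metric.isOpen_ball h0, sub_zero, smul_eq_mul]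
  ring

/-- Exponents: `inl k` is the tuple `(k, 0, …, 0)`, `inr l` is `l`. -/
def expo (r : ℕ) : ℕ ⊕ (Fin (r + 1) → ℚ) → (Fin (r + 1) → ℚ)
  | Sum.inl k => Pi.single 0 (k : ℚ)
  | Sum.inr l => l

lemma scaleProd_single (r k : ℕ) (x : ℝ) (hx : 0 < x) :
    scaleProd r (Pi.single 0 (k : ℚ)) x = x ^ k := by
  rw [scaleProd, Fin.prod_univ_succ]
  simp [logScale, abs_of_pos hx]

theorem statement13 (r : ℕ) (Λ : Finset (Fin (r + 1) → ℚ))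
    (hΛ' : ∀ l ∈ Λ, ¬((∃ k : ℕ, l 0 = k) ∧ ∀ i, i ≠ 0 → l i = 0))
    (e : (Fin (r + 1) → ℚ) → ℝ) (he : ∀ l ∈ Λ, e l ≠ 0)
    (η : ℝ) (hη : 0 < η) (hη' : r ≠ 0 → η ≤ (iterExp r)⁻¹)
    (M : ℕ) (hM : 1 ≤ M)
    (hhat : ℝ → ℝ) (hsm : ContDiffAt ℝ (M : ℕ∞) hhat 0)
    (δ : ℝ) (hδ : 0 < δ) (hδη : δ ≤ η)
    (hagree : ∀ x ∈ Set.Ioo (0 : ℝ) δ, hhat x = ∑ l ∈ Λ, e l * scaleProd r l x) :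
    ∀ m : ℕ, m < M → iteratedDeriv m hhat 0 = 0 := by
  classical
  intro m hm
  by_contra hne
  let a : ℕ → ℝ := fun k => (k.factorial : ℝ)⁻¹ * iteratedDeriv k hhat 0
  let c : ℕ ⊕ (Fin (r + 1) → ℚ) → ℝ := Sum.elim (fun k => -a k) e
  let T := (Finset.range (M + 1)).disjSum Λ
  let S := T.filter fun p => c p ≠ 0
  have hinj : ∀ p ∈ T, ∀ q ∈ T, p ≠ q → expo r p ≠ expo r q := by
    have hmix : ∀ k : ℕ, ∀ l ∈ Λ, (Pi.single 0 (k : ℚ) : Fin (r + 1) → ℚ) ≠ l := by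
      intro k l hl h
      refine hΛ' l hl ⟨⟨k, ?_⟩, fun i hi => ?_⟩
      · rw [← h]; simp
      · rw [← h]; simp [hi]
    rintro (p | p) hp (q | q) hq hpq h
    · have := congrFun h 0
      simp only [expo, Pi.single_eq_same, Nat.cast_inj] at this
      exact hpq (by rw [this])
    · exact hmix p q (by simpa [T] using hq) h
    · exact hmix q p (by simpa [T] using hp) h.symm
    · exact hpq (congrArg Sum.inr h)
  have hsum : (fun x => ∑ p ∈ S, c p * scaleProd r (expo r p) x)
      =o[𝓝[>] (0:ℝ)] (fun x => x ^ M) := by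
    refine (taylor_right M hhat hsm).congr' ?_ EventuallyEq.rfl
    filter_upwards [Ioo_mem_nhdsGT hδ] with x hx
    rw [hagree x hx]
    have h1 : ∑ p ∈ S, c p * scaleProd r (expo r p) x
        = ∑ p ∈ T, c p * scaleProd r (expo r p) x := by
      refine Finset.sum_filter_of_ne fun p _ hp h => hp ?_
      rw [h, zero_mul]
    rw [h1, Finset.sum_disjSum]
    simp only [c, Sum.elim_inl, Sum.elim_inr, expo, scaleProd_single r _ x hx.1, a,
      neg_mul, Finset.sum_neg_distrib]
    ring
  have hall := all_littleO (fun p => scaleProd r (expo r p)) (𝓝[>] (0:ℝ)) S c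
    (fun p hp => (Finset.mem_filter.1 hp).2)
    (fun p hp q hq hpq => scaleProd_compare r _ _
      (hinj p (Finset.mem_filter.1 hp).1 q (Finset.mem_filter.1 hq).1 hpq)) _ hsum
  have hmS : (Sum.inl m : ℕ ⊕ (Fin (r + 1) → ℚ)) ∈ S := by
    refine Finset.mem_filter.2 ⟨by simp [T]; omega, ?_⟩
    simp [c, a, hne, Nat.factorial_ne_zero]
  have h1 : (fun x : ℝ => x ^ m) =o[𝓝[>] (0:ℝ)] (fun x => x ^ M) := by
    refine (hall _ hmS).congr' ?_ EventuallyEq.rfl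
    filter_upwards [self_mem_nhdsWithin] with x hx
    exact scaleProd_single r m x hx
  have h2 : (fun x : ℝ => x ^ M) =o[𝓝[>] (0:ℝ)] (fun x => x ^ m) :=
    (isLittleO_pow_pow hm).mono nhdsWithin_le_nhds
  have h3 := (isLittleO_irrefl' (f' := fun x : ℝ => x ^ m) (l := 𝓝[>] (0:ℝ)) ?_) 
  · exact h3 (h1.trans h2)
  · refine Eventually.frequently ?_
    filter_upwards [self_mem_nhdsWithin] with x hx
    have : (0:ℝ) < x := hx
    simpa using pow_ne_zero m this.ne'
end
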